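/- Let G be a forest. Then G is well-covered (all maximal independent sets of G have the same cardinality) if and only if eᵀx takes a constant value over all x ∈ SOL(G). Moreover, if G is a well-covered forest with no isolated vertices, then eᵀx = |V(G)|/2 for every x ∈ SOL(G). -/

import Mathlib

open Matrix Finset

/-- `x` solves the linear complementarity problem `LCP(A + I, -e)`, where `A` is the
adjacency matrix of the simple graph `G`, `I` is the identity matrix and `e` is the
all-ones vector: `x ≥ 0`, `(A+I)x ≥ e`, and `xᵀ((A+I)x − e) = 0`. -/
def SolLCP {V : Type*} [Fintype V] [DecidableEq V] (G : SimpleGraph V) [DecidableRel G.Adj]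
    (x : V → ℝ) : Prop :=
  (∀ i, 0 ≤ x i) ∧
  (∀ i, 1 ≤ ((G.adjMatrix ℝ + 1) *ᵥ x) i) ∧
  ∑ i, x i * (((G.adjMatrix ℝ + 1) *ᵥ x) i - 1) = 0

/-- `S` is an independent set of the simple graph `G`: its vertices are pairwise nonadjacent. -/
def IsIndepFinset {V : Type*} (G : SimpleGraph V) (S : Finset V) : Prop :=
  ∀ i ∈ S, ∀ j ∈ S, ¬ G.Adj i j

/-- `S` is a maximal independent set of `G`: it is independent and is not properly
contained in any larger independent set. -/
def IsMaxIndepFinset {V : Type*} (G : SimpleGraph V) (S : Finset V) : Prop :=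
  IsIndepFinset G S ∧ ∀ T : Finset V, IsIndepFinset G T → S ⊆ T → S = T

section

variable {V : Type*} {G : SimpleGraph V}

theorem IsIndepFinset.isMaxIndepFinset {S : Finset V} (hS : IsIndepFinset G S)
    (h : ∀ v, v ∉ S → ∃ u ∈ S, G.Adj v u) : IsMaxIndepFinset G S := by
  refine ⟨hS, fun T hT hST => Subset.antisymm hST fun v hv => ?_⟩
  by_contra hvS
  obtain ⟨u, hu, huv⟩ := h v hvS
  exact hT v hv u (hST hu) huv

theorem IsMaxIndepFinset.exists_adj {S : Finset V} (hS : IsMaxIndepFinset G S) {v : V}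
    (hv : v ∉ S) : ∃ u ∈ S, G.Adj v u := by
  classical
  by_contra! h
  have hT : IsIndepFinset G (insert v S) := by
    intro i hi j hj hij
    rcases mem_insert.1 hi with hi | hi <;> rcases mem_insert.1 hj with hj | hj
    · exact hij.ne (hi.trans hj.symm)
    · exact h j hj (hi ▸ hij)
    · exact h i hi (hj ▸ hij.symm)
    · exact hS.1 i hi j hj hij
  exact hv (hS.2 _ hT (subset_insert v S) ▸ mem_insert_self v S)

theorem IsIndepFinset.exists_isMaxIndepFinset_superset [Finite V] {S : Finset V}
    (hS : IsIndepFinset G S) : ∃ T, S ⊆ T ∧ IsMaxIndepFinset G T := by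
  obtain ⟨T, hST, hT⟩ := Finite.exists_le_maximal hS
  exact ⟨T, hST, hT.1, fun U hU hTU => Subset.antisymm hTU (hT.2 hU hTU)⟩

variable [Fintype V] [DecidableEq V] [DecidableRel G.Adj]

theorem adjMatrix_add_one_mulVec_apply (x : V → ℝ) (v : V) :
    ((G.adjMatrix ℝ + 1) *ᵥ x) v = ∑ u ∈ G.neighborFinset v, x u + x v := by
  rw [Matrix.add_mulVec, Matrix.one_mulVec, Pi.add_apply, SimpleGraph.adjMatrix_mulVec_apply]

theorem IsMaxIndepFinset.solLCP {S : Finset V} (hS : IsMaxIndepFinset G S) :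
    SolLCP G (fun v => if v ∈ S then 1 else 0) := by
  have hnonneg : ∀ v : V, (0 : ℝ) ≤ if v ∈ S then 1 else 0 := fun v => by split_ifs <;> simp
  refine ⟨hnonneg, fun v => ?_, sum_eq_zero fun v _ => ?_⟩
  · rw [adjMatrix_add_one_mulVec_apply]
    by_cases hv : v ∈ S
    · rw [if_pos hv]
      exact le_add_of_nonneg_left (sum_nonneg fun u _ => hnonneg u)
    · obtain ⟨u, hu, huv⟩ := hS.exists_adj hv
      have := single_le_sum (f := fun u => if u ∈ S then (1 : ℝ) else 0)
        (fun u _ => hnonneg u) ((G.mem_neighborFinset v u).2 huv)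
      simpa [hu, hv] using this
  · by_cases hv : v ∈ S
    · rw [adjMatrix_add_one_mulVec_apply, sum_eq_zero fun u hu => if_neg fun huS =>
        hS.1 v hv u huS ((G.mem_neighborFinset v u).1 hu)]
      simp [hv]
    · simp [hv]

namespace SolLCP

variable {x : V → ℝ}

theorem one_le (hx : SolLCP G x) (v : V) : 1 ≤ ∑ u ∈ G.neighborFinset v, x u + x v :=
  adjMatrix_add_one_mulVec_apply (G := G) x v ▸ hx.2.1 v

theorem eq_one_of_pos (hx : SolLCP G x) {v : V} (hv : 0 < x v) :
    ∑ u ∈ G.neighborFinset v, x u + x v = 1 := by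
  have h := (sum_eq_zero_iff_of_nonneg fun i _ =>
    mul_nonneg (hx.1 i) (sub_nonneg.2 (hx.2.1 i))).1 hx.2.2 v (mem_univ v)
  rw [adjMatrix_add_one_mulVec_apply] at h
  exact sub_eq_zero.1 ((mul_eq_zero.1 h).resolve_left hv.ne')

theorem eq_one_of_isolated (hx : SolLCP G x) {v : V} (hv : ∀ u, ¬ G.Adj v u) : x v = 1 := by
  have hN : G.neighborFinset v = ∅ := by ext u; simp [hv u]
  have h := hx.one_le v
  rw [hN, sum_empty, zero_add] at h
  have h' := hx.eq_one_of_pos (zero_lt_one.trans_le h)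
  rwa [hN, sum_empty, zero_add] at h'

theorem add_eq_one_of_leaf (hx : SolLCP G x) {l u : V} (hlu : G.Adj l u)
    (hl : ∀ w, G.Adj l w → w = u) : x l + x u = 1 := by
  have hN : G.neighborFinset l = {u} := by
    ext w
    simp only [SimpleGraph.mem_neighborFinset, mem_singleton]
    exact ⟨hl w, fun h => h ▸ hlu⟩
  have h := hx.one_le l
  rw [hN, sum_singleton] at h
  rcases (hx.1 l).eq_or_lt with h0 | hpos
  · have hu := hx.eq_one_of_pos (v := u) (by linarith)
    have := sum_nonneg fun w (_ : w ∈ G.neighborFinset u) => hx.1 w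
    linarith
  · have := hx.eq_one_of_pos hpos
    rw [hN, sum_singleton] at this
    linarith

end SolLCP

end

section

variable {V : Type*} {G : SimpleGraph V}

theorem SimpleGraph.IsAcyclic.not_adj_of_adj_adj_adj (hG : G.IsAcyclic) {p a b q : V}
    (hpa : G.Adj p a) (hab : G.Adj a b) (hbq : G.Adj b q) (hpb : p ≠ b) (haq : a ≠ q) :
    ¬ G.Adj p q := by
  intro hpq
  have h₁ : (SimpleGraph.Walk.cons hpa (.cons hab (.cons hbq .nil))).IsPath := by
    simp [SimpleGraph.Walk.cons_isPath_iff, hpa.ne, hab.ne, hbq.ne, hpb, haq, hpq.ne]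
  have h₂ : (SimpleGraph.Walk.cons hpq .nil).IsPath := by
    simp [SimpleGraph.Walk.cons_isPath_iff, hpq.ne]
  have h := congrArg (fun P : G.Path p q => (P : G.Walk p q).length)
    ((hG.subsingleton_path p q).elim ⟨_, h₁⟩ ⟨_, h₂⟩)
  simp at h

variable [Fintype V]

open Classical in
/-- The isolated vertices of `G`. -/
noncomputable def isolatedFinset (G : SimpleGraph V) : Finset V :=
  univ.filter fun v => ∀ u, ¬ G.Adj v u

open Classical in
/-- The non-isolated vertices of color `i`. -/
noncomputable def colorFinset (c : G.Coloring (Fin 2)) (i : Fin 2) : Finset V :=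
  univ.filter fun v => c v = i ∧ ∃ u, G.Adj v u

theorem mem_isolatedFinset {v : V} : v ∈ isolatedFinset G ↔ ∀ u, ¬ G.Adj v u := by
  simp [isolatedFinset]

theorem mem_colorFinset {c : G.Coloring (Fin 2)} {i : Fin 2} {v : V} :
    v ∈ colorFinset c i ↔ c v = i ∧ ∃ u, G.Adj v u := by
  simp [colorFinset]

theorem disjoint_colorFinset_isolatedFinset (c : G.Coloring (Fin 2)) (i : Fin 2) :
    Disjoint (colorFinset c i) (isolatedFinset G) := by
  rw [disjoint_left]
  intro v hv hz
  obtain ⟨u, hu⟩ := (mem_colorFinset.1 hv).2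
  exact mem_isolatedFinset.1 hz u hu

variable [DecidableEq V]

theorem isMaxIndepFinset_colorFinset_union (c : G.Coloring (Fin 2)) (i : Fin 2) :
    IsMaxIndepFinset G (colorFinset c i ∪ isolatedFinset G) := by
  refine IsIndepFinset.isMaxIndepFinset (fun u hu v hv huv => ?_) fun v hv => ?_
  · simp only [mem_union, mem_colorFinset, mem_isolatedFinset] at hu hv
    rcases hu with hu | hu
    · rcases hv with hv | hv
      · exact c.valid huv (hu.1.trans hv.1.symm)
      · exact hv u huv.symm
    · exact hu v huv
  · simp only [mem_union, mem_colorFinset, mem_isolatedFinset, not_or, not_and] at hv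
    obtain ⟨hc, hz⟩ := hv
    push Not at hz
    obtain ⟨u, hu⟩ := hz
    have hvi : c v ≠ i := fun h => hc h ⟨u, hu⟩
    have hvu : c v ≠ c u := c.valid hu
    exact ⟨u, mem_union_left _ (mem_colorFinset.2 ⟨by omega, v, hu.symm⟩), hu⟩

/-- A bipartite well-covered graph has a matching covering all its non-isolated vertices. -/
theorem exists_matching_of_wellCovered (c : G.Coloring (Fin 2))
    (hwc : ∀ S T : Finset V, IsMaxIndepFinset G S → IsMaxIndepFinset G T → S.card = T.card) :
    ∃ f : V → V, (∀ a ∈ colorFinset c 0, G.Adj a (f a)) ∧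
      ∀ g : V → ℝ, ∑ v, g v =
        ∑ a ∈ colorFinset c 0, (g a + g (f a)) + ∑ z ∈ isolatedFinset G, g z := by
  classical
  have hcard : (colorFinset c 0).card = (colorFinset c 1).card := by
    have h := hwc _ _ (isMaxIndepFinset_colorFinset_union c 0)
      (isMaxIndepFinset_colorFinset_union c 1)
    rw [card_union_of_disjoint (disjoint_colorFinset_isolatedFinset c 0),
      card_union_of_disjoint (disjoint_colorFinset_isolatedFinset c 1)] at h
    omega
  have hadj : ∀ {u v}, G.Adj u v → u ∈ colorFinset c 0 → v ∈ colorFinset c 1 := by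
    intro u v huv hu
    have h0 := (mem_colorFinset.1 hu).1
    have h1 : c u ≠ c v := c.valid huv
    exact mem_colorFinset.2 ⟨by omega, u, huv.symm⟩
  have hall : ∀ s : Finset (colorFinset c 0),
      s.card ≤ (s.biUnion fun a => G.neighborFinset a).card := by
    intro s
    set N := s.biUnion fun a => G.neighborFinset a with hN
    set S := s.map (Function.Embedding.subtype _) with hS
    have hS0 : ∀ v ∈ S, v ∈ colorFinset c 0 ∧ ∀ u, G.Adj v u → u ∈ N := by
      intro v hv
      obtain ⟨a, ha, rfl⟩ := mem_map.1 hv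
      exact ⟨a.2, fun u hu => mem_biUnion.2 ⟨a, ha, (G.mem_neighborFinset _ _).2 hu⟩⟩
    have hNsub : N ⊆ colorFinset c 1 := by
      intro u hu
      obtain ⟨a, -, ha⟩ := mem_biUnion.1 hu
      exact hadj ((G.mem_neighborFinset _ _).1 ha) a.2
    have hmax := isMaxIndepFinset_colorFinset_union c 1
    have hind : IsIndepFinset G (S ∪ ((colorFinset c 1 ∪ isolatedFinset G) \ N)) := by
      intro u hu v hv huv
      rcases mem_union.1 hu with hu | hu <;> rcases mem_union.1 hv with hv | hv
      · exact c.valid huv ((mem_colorFinset.1 (hS0 u hu).1).1.trans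
          (mem_colorFinset.1 (hS0 v hv).1).1.symm)
      · exact (mem_sdiff.1 hv).2 ((hS0 u hu).2 v huv)
      · exact (mem_sdiff.1 hu).2 ((hS0 v hv).2 u huv.symm)
      · exact hmax.1 u (mem_sdiff.1 hu).1 v (mem_sdiff.1 hv).1 huv
    obtain ⟨T, hST, hT⟩ := hind.exists_isMaxIndepFinset_superset
    have hle := card_le_card hST
    have hdis : Disjoint S ((colorFinset c 1 ∪ isolatedFinset G) \ N) := by
      rw [disjoint_left]
      intro v hv hv'
      have h0 := (hS0 v hv).1
      rcases mem_union.1 (mem_sdiff.1 hv').1 with h | h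
      · have := (mem_colorFinset.1 h0).1.symm.trans (mem_colorFinset.1 h).1
        exact absurd this (by decide)
      · exact disjoint_left.1 (disjoint_colorFinset_isolatedFinset c 0) h0 h
    have hsub : N ⊆ colorFinset c 1 ∪ isolatedFinset G := hNsub.trans subset_union_left
    rw [card_union_of_disjoint hdis, card_sdiff_of_subset hsub, hwc _ _ hT hmax] at hle
    have hScard : S.card = s.card := card_map _
    have := card_le_card hsub
    omega
  obtain ⟨f, hinj, hf⟩ := (all_card_le_biUnion_card_iff_exists_injective _).1 hall
  have hf' : ∀ a : colorFinset c 0, G.Adj a (f a) := fun a => (G.mem_neighborFinset _ _).1 (hf a)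
  let F : V → V := fun v => if h : v ∈ colorFinset c 0 then f ⟨v, h⟩ else v
  have hF : ∀ v (h : v ∈ colorFinset c 0), F v = f ⟨v, h⟩ := fun v h => dif_pos h
  have hFinj : Set.InjOn F (colorFinset c 0) := by
    intro u hu v hv huv
    rw [hF u hu, hF v hv] at huv
    exact congrArg Subtype.val (hinj huv)
  have himage : (colorFinset c 0).image F = colorFinset c 1 := by
    refine eq_of_subset_of_card_le (fun u hu => ?_) ?_
    · obtain ⟨a, ha, rfl⟩ := mem_image.1 hu
      rw [hF a ha]
      exact hadj (hf' ⟨a, ha⟩) ha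
    · rw [card_image_of_injOn hFinj, hcard]
  refine ⟨F, fun a ha => hF a ha ▸ hf' ⟨a, ha⟩, fun g => ?_⟩
  have huniv : (univ : Finset V) =
      (colorFinset c 0 ∪ colorFinset c 1) ∪ isolatedFinset G := by
    ext v
    simp only [mem_univ, mem_union, mem_colorFinset, mem_isolatedFinset, true_iff]
    by_cases h : ∃ u, G.Adj v u
    · have : c v = 0 ∨ c v = 1 := by omega
      tauto
    · push Not at h
      exact Or.inr h
  have h01 : Disjoint (colorFinset c 0) (colorFinset c 1) := by
    rw [disjoint_left]
    intro v h0 h1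
    have := (mem_colorFinset.1 h0).1.symm.trans (mem_colorFinset.1 h1).1
    exact absurd this (by decide)
  rw [huniv, sum_union (disjoint_union_left.2 ⟨disjoint_colorFinset_isolatedFinset c 0,
    disjoint_colorFinset_isolatedFinset c 1⟩), sum_union h01, sum_add_distrib, ← himage,
    sum_image hFinj]

theorem SolLCP.sum_eq_card_of_wellCovered [DecidableRel G.Adj] (hG : G.IsAcyclic)
    (c : G.Coloring (Fin 2))
    (hwc : ∀ S T : Finset V, IsMaxIndepFinset G S → IsMaxIndepFinset G T → S.card = T.card)
    {x : V → ℝ} (hx : SolLCP G x) :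
    ∑ v, x v = (colorFinset c 0).card + (isolatedFinset G).card := by
  obtain ⟨f, hf, hsum⟩ := exists_matching_of_wellCovered c hwc
  have hz : ∑ z ∈ isolatedFinset G, x z = (isolatedFinset G).card := by
    rw [sum_congr rfl fun z hz => hx.eq_one_of_isolated (mem_isolatedFinset.1 hz)]
    simp
  have he : ∀ a ∈ colorFinset c 0, x a + x (f a) = 1 := by
    intro a ha
    have hab := hf a ha
    by_cases hl : ∀ w, G.Adj a w → w = f a
    · exact hx.add_eq_one_of_leaf hab hl
    by_cases hl' : ∀ w, G.Adj (f a) w → w = a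
    · rw [add_comm]
      exact hx.add_eq_one_of_leaf hab.symm hl'
    push Not at hl hl'
    obtain ⟨p, hap, hpb⟩ := hl
    obtain ⟨q, hbq, hqa⟩ := hl'
    have hpq := hG.not_adj_of_adj_adj_adj hap.symm hab hbq hpb hqa.symm
    have hind : IsIndepFinset G {p, q} := by
      intro u hu v hv huv
      simp only [mem_insert, mem_singleton] at hu hv
      rcases hu with rfl | rfl <;> rcases hv with rfl | rfl
      · exact huv.ne rfl
      · exact hpq huv
      · exact hpq huv.symm
      · exact huv.ne rfl
    obtain ⟨T, hST, hT⟩ := hind.exists_isMaxIndepFinset_superset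
    have haT : a ∉ T := fun h => hT.1 a h p (hST (by simp)) hap
    have hbT : f a ∉ T := fun h => hT.1 (f a) h q (hST (by simp)) hbq
    have hcard := hwc _ _ hT (isMaxIndepFinset_colorFinset_union c 0)
    rw [card_union_of_disjoint (disjoint_colorFinset_isolatedFinset c 0)] at hcard
    have h := hsum fun v => if v ∈ T then 1 else 0
    have hlt : ∑ u ∈ colorFinset c 0,
        (((if u ∈ T then 1 else 0) + if f u ∈ T then 1 else 0 : ℝ)) <
        ∑ u ∈ colorFinset c 0, 1 := by
      refine sum_lt_sum (fun u hu => ?_) ⟨a, ha, by simp [haT, hbT]⟩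
      by_cases h1 : u ∈ T
      · have h2 : f u ∉ T := fun h2 => hT.1 u h1 (f u) h2 (hf u hu)
        simp [h1, h2]
      · simp only [h1, if_false, zero_add]
        split_ifs <;> simp
    have hle : ∑ z ∈ isolatedFinset G, (if z ∈ T then (1 : ℝ) else 0) ≤
        ∑ z ∈ isolatedFinset G, 1 := sum_le_sum fun z _ => by split_ifs <;> simp
    simp only [sum_const, nsmul_eq_mul, mul_one] at hlt hle
    have hTsum : ∑ v, (if v ∈ T then (1 : ℝ) else 0) = T.card := by simp
    rw [hTsum, hcard] at h
    push_cast at h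
    linarith
  rw [hsum x, hz, sum_congr rfl he]
  simp

end

/-- A forest `G` is well-covered (all maximal independent sets have the same cardinality)
if and only if `eᵀx` takes a constant value over all solutions `x` of `LCP(G)`.
Moreover, if `G` is a well-covered forest with no isolated vertices, then `eᵀx = |V(G)|/2`
for every solution `x` of `LCP(G)`. -/
theorem stmt_18 {n : ℕ} (G : SimpleGraph (Fin n)) [DecidableRel G.Adj] (hG : G.IsAcyclic) :
    ((∀ S T : Finset (Fin n), IsMaxIndepFinset G S → IsMaxIndepFinset G T →
        S.card = T.card) ↔
      ∃ c : ℝ, ∀ x : Fin n → ℝ, SolLCP G x → ∑ i, x i = c) ∧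
    ((∀ S T : Finset (Fin n), IsMaxIndepFinset G S → IsMaxIndepFinset G T →
        S.card = T.card) →
      (∀ v : Fin n, ∃ u : Fin n, G.Adj v u) →
      ∀ x : Fin n → ℝ, SolLCP G x → ∑ i, x i = (n : ℝ) / 2) := by
  obtain ⟨c⟩ := hG.isBipartite
  refine ⟨⟨fun hwc => ⟨_, fun x hx => hx.sum_eq_card_of_wellCovered hG c hwc⟩, ?_⟩, ?_⟩
  · rintro ⟨r, hr⟩ S T hS hT
    have h := (hr _ hS.solLCP).trans (hr _ hT.solLCP).symm
    simpa using h
  · intro hwc hiso x hx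
    have hZ : isolatedFinset G = ∅ := by
      refine eq_empty_of_forall_notMem fun v hv => ?_
      obtain ⟨u, hu⟩ := hiso v
      exact mem_isolatedFinset.1 hv u hu
    rw [hx.sum_eq_card_of_wellCovered hG c hwc]
    obtain ⟨f, -, hsum⟩ := exists_matching_of_wellCovered c hwc
    have h := hsum fun _ => 1
    simp only [hZ, sum_const, card_empty, card_univ, Fintype.card_fin, nsmul_eq_mul] at h
    rw [hZ, card_empty]
    push_cast at h ⊢
    linarith
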